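/- Every graph G either contains k vertex-disjoint cycles or has a feedback vertex set of size at most 12k² − 27k + 15, for every integer k ≥ 2. -/

import Mathlib

set_option linter.unusedSectionVars false

namespace EP
open Finset Classical

variable {V : Type*} [Fintype V]

/-- A nonempty vertex set in which every vertex has two neighbours inside the set. -/
def Core (G : SimpleGraph V) (A : Finset V) : Prop :=
  A.Nonempty ∧ ∀ x ∈ A, ∃ y ∈ A, ∃ z ∈ A, y ≠ z ∧ G.Adj x y ∧ G.Adj x z

/-- `k` disjoint cores. -/
def Pack (G : SimpleGraph V) (k : ℕ) : Prop :=
  ∃ f : Fin k → Finset V, (∀ i, Core G (f i)) ∧ ∀ i j, i ≠ j → Disjoint (f i) (f j)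

theorem Core.mono {G H : SimpleGraph V} (h : H ≤ G) {A : Finset V} (hA : Core H A) : Core G A := by
  refine ⟨hA.1, fun x hx => ?_⟩
  obtain ⟨y, hy, z, hz, hne, h1, h2⟩ := hA.2 x hx
  exact ⟨y, hy, z, hz, hne, h h1, h h2⟩

theorem Pack.mono {G H : SimpleGraph V} (h : H ≤ G) {k : ℕ} (hA : Pack H k) : Pack G k := by
  obtain ⟨f, hf, hd⟩ := hA
  exact ⟨f, fun i => (hf i).mono h, hd⟩

theorem core_cycle {G : SimpleGraph V} {A : Finset V} (hA : Core G A) :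
    ∃ (v : V) (c : G.Walk v v), c.IsCycle ∧ ∀ x ∈ c.support, x ∈ A := by
  by_cases hac : (G.induce (A : Set V)).IsAcyclic
  · exfalso
    have key : ∀ n : ℕ, ∃ (u v : (A : Set V)) (p : (G.induce (A : Set V)).Walk u v),
        p.IsPath ∧ p.length = n := by
      intro n
      induction n with
      | zero =>
        obtain ⟨x, hx⟩ := hA.1
        exact ⟨⟨x, hx⟩, ⟨x, hx⟩, SimpleGraph.Walk.nil, by simp, rfl⟩
      | succ n ih =>
        obtain ⟨u, v, p, hp, hl⟩ := ih
        obtain ⟨y, hy, z, hz, hne, h1, h2⟩ := hA.2 u u.2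
        have ex : ∀ y (hy : y ∈ A), G.Adj u y → (⟨y, hy⟩ : (A : Set V)) ∉ p.support →
            ∃ (u v : (A : Set V)) (p : (G.induce (A : Set V)).Walk u v),
        p.IsPath ∧ p.length = n + 1 := by
          intro y hy hadj hns
          have ha : (G.induce (A : Set V)).Adj ⟨y, hy⟩ u := by simpa using hadj.symm
          exact ⟨⟨y, hy⟩, v, SimpleGraph.Walk.cons ha p, hp.cons hns, by simp [hl]⟩
        by_cases hys : (⟨y, hy⟩ : (A : Set V)) ∈ p.support
        · by_cases hzs : (⟨z, hz⟩ : (A : Set V)) ∈ p.support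
          · have e1 := hac.eq_snd_of_adj_start hp (by simpa using h1) hys
            have e2 := hac.eq_snd_of_adj_start hp (by simpa using h2) hzs
            rw [← e2] at e1
            exact absurd (congrArg Subtype.val e1) hne
          · exact ex z hz h2 hzs
        · exact ex y hy h1 hys
    obtain ⟨u, v, p, hp, hl⟩ := key (Fintype.card (A : Set V))
    have := hp.length_lt
    omega
  · unfold SimpleGraph.IsAcyclic at hac
    push Not at hac
    obtain ⟨v, c, hc⟩ := hac
    refine ⟨_, c.map (SimpleGraph.Embedding.induce (G := G) (A : Set V)).toHom, ?_, ?_⟩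
    · exact hc.map (SimpleGraph.Embedding.induce (G := G) (A : Set V)).injective
    · intro x hx
      rw [SimpleGraph.Walk.support_map] at hx
      obtain ⟨y, hy, rfl⟩ := List.mem_map.1 hx
      exact y.2

theorem cycle_core {G : SimpleGraph V} {v : V} {c : G.Walk v v} (hc : c.IsCycle) :
    Core G c.support.toFinset := by
  refine ⟨⟨v, by simp⟩, fun x hx => ?_⟩
  have h2 := hc.ncard_neighborSet_toSubgraph_eq_two (by simpa using hx)
  obtain ⟨y, z, hne, he⟩ := Set.ncard_eq_two.1 h2
  have hy : c.toSubgraph.Adj x y := by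
    have : y ∈ c.toSubgraph.neighborSet x := by rw [he]; simp
    exact this
  have hz : c.toSubgraph.Adj x z := by
    have : z ∈ c.toSubgraph.neighborSet x := by rw [he]; simp
    exact this
  exact ⟨y, by simpa using SimpleGraph.Walk.mem_support_of_adj_toSubgraph hy.symm,
    z, by simpa using SimpleGraph.Walk.mem_support_of_adj_toSubgraph hz.symm,
    hne, hy.adj_sub, hz.adj_sub⟩

/-- If all but one vertex have two neighbours inside and the exceptional one has one,
there is a core inside. -/
theorem core_of_exception {G : SimpleGraph V} : ∀ (n : ℕ) (A : Finset V) (w : V), A.card ≤ n →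
    w ∈ A → (∃ y ∈ A, G.Adj w y) →
    (∀ x ∈ A, x ≠ w → ∃ y ∈ A, ∃ z ∈ A, y ≠ z ∧ G.Adj x y ∧ G.Adj x z) →
    ∃ B ⊆ A, Core G B := by
  intro n
  induction n with
  | zero =>
    intro A w hc hw
    have : A = ∅ := by simpa using hc
    simp [this] at hw
  | succ n ih =>
    intro A w hc hw ⟨y, hy, hwy⟩ hA
    by_cases h : ∃ z ∈ A, y ≠ z ∧ G.Adj w z
    · obtain ⟨z, hz, hyz, hwz⟩ := h
      refine ⟨A, Subset.rfl, ⟨w, hw⟩, fun x hx => ?_⟩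
      by_cases hxw : x = w
      · subst hxw
        exact ⟨y, hy, z, hz, hyz, hwy, hwz⟩
      · exact hA x hx hxw
    · push Not at h
      have hyw : y ≠ w := hwy.ne'
      obtain ⟨B, hB, hBc⟩ := ih (A.erase w) y (by rw [card_erase_of_mem hw]; omega)
        (mem_erase.2 ⟨hyw, hy⟩)
        (by
          obtain ⟨a, ha, b, hb, hab, h1, h2⟩ := hA y hy hyw
          by_cases haw : a = w
          · exact ⟨b, mem_erase.2 ⟨by rintro rfl; exact hab haw, hb⟩, h2⟩
          · exact ⟨a, mem_erase.2 ⟨haw, ha⟩, h1⟩)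
        (by
          intro x hx hxy
          obtain ⟨hxw, hxA⟩ := mem_erase.1 hx
          obtain ⟨a, ha, b, hb, hab, h1, h2⟩ := hA x hxA hxw
          have hne : ∀ c, G.Adj x c → c ≠ w := by
            rintro c hc rfl
            exact h x hxA (Ne.symm hxy) hc.symm
          exact ⟨a, mem_erase.2 ⟨hne a h1, ha⟩, b, mem_erase.2 ⟨hne b h2, hb⟩, hab, h1, h2⟩)
      exact ⟨B, hB.trans (erase_subset _ _), hBc⟩

/-! ### degrees and the potential -/

noncomputable def nb (H : SimpleGraph V) (x : V) : Finset V := univ.filter fun y => H.Adj x y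

noncomputable def dg (H : SimpleGraph V) (x : V) : ℕ := (nb H x).card

@[simp] theorem mem_nb {H : SimpleGraph V} {x y : V} : y ∈ nb H x ↔ H.Adj x y := by simp [nb]

def phi (d : ℕ) : ℤ := if d = 0 then 0 else (d : ℤ) - 2

noncomputable def Phi (H : SimpleGraph V) : ℤ := ∑ x, phi (dg H x)

noncomputable def M (H : SimpleGraph V) : ℕ := ∑ x, dg H x

def del (H : SimpleGraph V) (C : Finset V) : SimpleGraph V where
  Adj x y := H.Adj x y ∧ x ∉ C ∧ y ∉ C
  symm := ⟨fun _ _ h => ⟨h.1.symm, h.2.2, h.2.1⟩⟩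
  loopless := ⟨fun _ h => h.1.ne rfl⟩

theorem del_le (H : SimpleGraph V) (C : Finset V) : del H C ≤ H := fun _ _ h => h.1

theorem dg_mono {H G : SimpleGraph V} (h : H ≤ G) (x : V) : dg H x ≤ dg G x :=
  card_le_card fun y hy => by simp at hy ⊢; exact h hy

theorem M_lt {H G : SimpleGraph V} (h : ∀ x, dg H x ≤ dg G x) (x : V) (hx : dg H x < dg G x) :
    M H < M G := sum_lt_sum (fun x _ => h x) ⟨x, mem_univ _, hx⟩

theorem phi_sub (d j : ℕ) : phi (d + j) - j ≤ phi d := by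
  unfold phi; split_ifs <;> push_cast <;> omega

theorem dg_eq_zero {H : SimpleGraph V} {x : V} : dg H x = 0 ↔ ∀ y, ¬ H.Adj x y := by
  simp [dg, nb, filter_eq_empty_iff]

theorem dg_del_of_mem (H : SimpleGraph V) {C : Finset V} {x : V} (hx : x ∈ C) :
    dg (del H C) x = 0 := dg_eq_zero.2 fun _ h => h.2.1 hx

theorem dg_del (H : SimpleGraph V) {C : Finset V} {x : V} (hx : x ∉ C) :
    dg (del H C) x + (nb H x ∩ C).card = dg H x := by
  have : nb (del H C) x = nb H x \ C := by
    ext y; simp [del, hx]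
  rw [dg, dg, this, card_sdiff_add_card_inter]

theorem sum_cut (H : SimpleGraph V) (C : Finset V) :
    ∑ x ∈ Cᶜ, ((nb H x ∩ C).card) = ∑ c ∈ C, (nb H c \ C).card := by
  have := sum_card_bipartiteAbove_eq_sum_card_bipartiteBelow (s := Cᶜ) (t := C) H.Adj
  convert this using 2 with x hx x hx
  · congr 1; ext y; simp [mem_bipartiteAbove, and_comm]
  · congr 1; ext y; simp [mem_bipartiteBelow, and_comm, H.adj_comm]

theorem Phi_del (H : SimpleGraph V) (C : Finset V) :
    Phi H - ∑ c ∈ C, (phi (dg H c) + ((nb H c \ C).card : ℤ)) ≤ Phi (del H C) := by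
  have e1 : Phi H = ∑ x ∈ C, phi (dg H x) + ∑ x ∈ Cᶜ, phi (dg H x) :=
    (sum_add_sum_compl C _).symm
  have e2 : Phi (del H C) = ∑ x ∈ Cᶜ, phi (dg (del H C) x) := by
    rw [Phi, ← sum_add_sum_compl C, sum_eq_zero, zero_add]
    intro x hx; rw [dg_del_of_mem H hx]; rfl
  have e3 := sum_cut H C
  have e4 : ∑ x ∈ Cᶜ, (phi (dg H x) - ((nb H x ∩ C).card : ℤ)) ≤ ∑ x ∈ Cᶜ, phi (dg (del H C) x) := by
    apply sum_le_sum
    intro x hx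
    rw [← dg_del H (by simpa using hx : x ∉ C)]
    exact phi_sub _ _
  rw [sum_sub_distrib, ← Nat.cast_sum, e3] at e4
  rw [sum_add_distrib, ← Nat.cast_sum]
  linarith

theorem dg_core {H : SimpleGraph V} {C : Finset V} (hC : Core H C) {c : V} (hc : c ∈ C) :
    2 + (nb H c \ C).card ≤ dg H c := by
  obtain ⟨y, hy, z, hz, hne, h1, h2⟩ := hC.2 c hc
  have : 2 ≤ (nb H c ∩ C).card := by
    rw [← card_pair hne]
    apply card_le_card
    intro w hw
    simp only [mem_insert, mem_singleton] at hw
    rcases hw with rfl | rfl <;> simp [*]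
  have := card_sdiff_add_card_inter (nb H c) C
  unfold dg; omega

theorem Phi_del_core {H : SimpleGraph V} (hH : ∀ x, dg H x ≤ 3) {C : Finset V} (hC : Core H C) :
    Phi H - 2 * ((C.filter fun c => dg H c = 3).card : ℤ) ≤ Phi (del H C) := by
  refine le_trans ?_ (Phi_del H C)
  apply sub_le_sub_left
  rw [card_filter, Nat.cast_sum, mul_sum]
  apply sum_le_sum
  intro c hc
  have h1 := dg_core hC hc
  have h2 := hH c
  unfold phi
  split_ifs <;> push_cast <;> omega

theorem Pack.insert {H : SimpleGraph V} {C : Finset V} {k : ℕ} (hC : Core H C)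
    (h : Pack (del H C) k) : Pack H (k + 1) := by
  obtain ⟨f, hf, hd⟩ := h
  have hdis : ∀ i, Disjoint C (f i) := by
    intro i
    rw [disjoint_left]
    intro x hx hx'
    obtain ⟨y, -, z, -, -, h1, -⟩ := (hf i).2 x hx'
    exact h1.2.1 hx
  refine ⟨Fin.cons C f, ?_, ?_⟩
  · intro i
    refine Fin.cases ?_ (fun i => ?_) i
    · simpa using hC
    · simpa using (hf i).mono (del_le _ _)
  · intro i j
    refine Fin.cases ?_ (fun i => ?_) i <;> refine Fin.cases ?_ (fun j => ?_) j
    · simp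
    · intro _; simpa using hdis j
    · intro _; simpa using (hdis i).symm
    · intro h
      simpa using hd i j (by rintro rfl; exact h rfl)

theorem Phi_del_leaf {H : SimpleGraph V} {v : V} (hv : dg H v = 1) :
    Phi H ≤ Phi (del H {v}) := by
  have := Phi_del H {v}
  have h2 : (nb H v \ {v}).card ≤ 1 := (card_le_card sdiff_subset).trans hv.le
  simp only [sum_singleton, hv] at this
  have : phi 1 = -1 := rfl
  omega

theorem M_del_lt {H : SimpleGraph V} {C : Finset V} {v : V} (hv : v ∈ C) (h : dg H v ≠ 0) :
    M (del H C) < M H := by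
  refine M_lt (dg_mono (del_le _ _)) v ?_
  rw [dg_del_of_mem H hv]; omega

theorem exists_two_of_dg {H : SimpleGraph V} {v : V} (h : 2 ≤ dg H v) :
    ∃ a b, a ≠ b ∧ H.Adj v a ∧ H.Adj v b := by
  obtain ⟨a, ha, b, hb, hab⟩ := one_lt_card.1 (show 1 < (nb H v).card from h)
  exact ⟨a, b, hab, by simpa using ha, by simpa using hb⟩

/-- A graph with an edge and potential at least `-1` contains a core. -/
theorem base : ∀ (n : ℕ) (H : SimpleGraph V), M H ≤ n → (∃ x y, H.Adj x y) → -1 ≤ Phi H →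
    ∃ A, Core H A := by
  intro n
  induction n with
  | zero =>
    rintro H hM ⟨x, y, hxy⟩ -
    have : dg H x = 0 := by
      have := single_le_sum (f := dg H) (fun _ _ => Nat.zero_le _) (mem_univ x)
      unfold M at hM; omega
    exact absurd hxy (dg_eq_zero.1 this y)
  | succ n ih =>
    rintro H hM ⟨x, y, hxy⟩ hP
    by_cases hl : ∃ v, dg H v = 1
    · obtain ⟨v, hv⟩ := hl
      by_cases he : ∃ x y, (del H {v}).Adj x y
      · obtain ⟨A, hA⟩ := ih (del H {v})
          (by have := M_del_lt (H := H) (mem_singleton_self v) (by omega); omega) he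
          (hP.trans (Phi_del_leaf hv))
        exact ⟨A, hA.mono (del_le _ _)⟩
      · exfalso
        push Not at he
        obtain ⟨w, hw⟩ := card_eq_one.1 (show (nb H v).card = 1 from hv)
        have hvw : H.Adj v w := by rw [← mem_nb, hw]; simp
        have hsmall : ∀ x, x ≠ v → dg H x ≤ 1 := by
          intro x hx
          by_contra hc
          obtain ⟨a, b, hab, h1, h2⟩ := exists_two_of_dg (H := H) (v := x) (by omega)
          by_cases hav : a = v
          · exact he x b ⟨h2, by simpa using hx, by
              simp; rintro rfl; exact hab hav⟩
          · exact he x a ⟨h1, by simpa using hx, by simpa using hav⟩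
        have hw1 : dg H w = 1 := by
          have h1 := hsmall w hvw.ne'
          have h2 : dg H w ≠ 0 := fun h0 => dg_eq_zero.1 h0 v hvw.symm
          omega
        have hle : ∀ x, phi (dg H x) ≤ 0 := by
          intro x
          by_cases hx : x = v
          · subst hx; rw [hv]; decide
          · have := hsmall x hx
            unfold phi; split_ifs <;> omega
        have : Phi H ≤ ∑ x ∈ {v, w}, phi (dg H x) := by
          apply sum_le_sum_of_subset_of_nonpos' 
          · exact subset_univ _
          · intro x _ _; exact hle x
        rw [sum_pair hvw.ne, hv, hw1] at this
        have h3 : phi 1 = -1 := rfl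
        omega
    · push Not at hl
      refine ⟨univ.filter fun x => dg H x ≠ 0, ⟨x, ?_⟩, ?_⟩
      · simp only [mem_filter, mem_univ, true_and]
        exact fun h0 => dg_eq_zero.1 h0 y hxy
      · intro z hz
        simp only [mem_filter, mem_univ, true_and] at hz
        obtain ⟨a, b, hab, h1, h2⟩ := exists_two_of_dg (H := H) (v := z) (by
          have := hl z; omega)
        refine ⟨a, ?_, b, ?_, hab, h1, h2⟩
        · simp only [mem_filter, mem_univ, true_and]
          exact fun h0 => dg_eq_zero.1 h0 z h1.symm
        · simp only [mem_filter, mem_univ, true_and]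
          exact fun h0 => dg_eq_zero.1 h0 z h2.symm

/-! ### short cores -/

noncomputable def bl (H : SimpleGraph V) (u : V) : ℕ → Finset V
  | 0 => ∅
  | i + 1 => insert u (bl H u i ∪ univ.filter fun x => ∃ y ∈ bl H u i, H.Adj y x)

noncomputable def ly (H : SimpleGraph V) (u : V) (i : ℕ) : Finset V := bl H u (i + 1) \ bl H u i

theorem mem_bl_succ {H : SimpleGraph V} {u x : V} {i : ℕ} :
    x ∈ bl H u (i + 1) ↔ x = u ∨ x ∈ bl H u i ∨ ∃ y ∈ bl H u i, H.Adj y x := by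
  simp [bl]

theorem ly_parent {H : SimpleGraph V} {u x : V} {i : ℕ} (hx : x ∈ ly H u (i + 1)) :
    ∃ y ∈ ly H u i, H.Adj x y := by
  obtain ⟨h1, h2⟩ := mem_sdiff.1 hx
  rcases mem_bl_succ.1 h1 with rfl | h | ⟨y, hy, hyx⟩
  · exact absurd (mem_bl_succ.2 (Or.inl rfl)) h2
  · exact absurd h h2
  · refine ⟨y, mem_sdiff.2 ⟨hy, fun h => h2 ?_⟩, hyx.symm⟩
    exact mem_bl_succ.2 (Or.inr (Or.inr ⟨y, h, hyx⟩))

theorem ly_nbr {H : SimpleGraph V} {u x y : V} {i : ℕ} (hx : x ∈ ly H u (i + 1)) (h : H.Adj x y) :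
    y ∈ ly H u i ∨ y ∈ ly H u (i + 1) ∨ y ∈ ly H u (i + 2) := by
  obtain ⟨h1, h2⟩ := mem_sdiff.1 hx
  have h3 : y ∈ bl H u (i + 3) := mem_bl_succ.2 (Or.inr (Or.inr ⟨x, h1, h⟩))
  by_cases h4 : y ∈ bl H u (i + 2)
  · by_cases h5 : y ∈ bl H u (i + 1)
    · left
      refine mem_sdiff.2 ⟨h5, fun h6 => h2 ?_⟩
      exact mem_bl_succ.2 (Or.inr (Or.inr ⟨y, h6, h.symm⟩))
    · right; left; exact mem_sdiff.2 ⟨h4, h5⟩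
  · right; right; exact mem_sdiff.2 ⟨h3, h4⟩

theorem ly_zero {H : SimpleGraph V} {u : V} : ly H u 0 = {u} := by
  ext x; simp [ly, bl]

theorem u_mem_bl {H : SimpleGraph V} {u : V} (i : ℕ) : u ∈ bl H u (i + 1) :=
  mem_bl_succ.2 (Or.inl rfl)

theorem ly_path {H : SimpleGraph V} {u : V} : ∀ (i : ℕ) (y : V), y ∈ ly H u i →
    ∃ P : Finset V, P.card ≤ i + 1 ∧ u ∈ P ∧ y ∈ P ∧ (∀ z ∈ P, z = y ∨ z ∈ bl H u i) ∧
      (∀ z ∈ P, z ≠ u → z ≠ y → ∃ a ∈ P, ∃ b ∈ P, a ≠ b ∧ H.Adj z a ∧ H.Adj z b) ∧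
      (y ≠ u → ∃ a ∈ P, H.Adj y a) ∧ (y ≠ u → ∃ a ∈ P, H.Adj u a) := by
  intro i
  induction i with
  | zero =>
    intro y hy
    rw [ly_zero, mem_singleton] at hy
    subst hy
    exact ⟨{y}, by simp⟩
  | succ i ih =>
    intro y hy
    obtain ⟨w, hw, hyw⟩ := ly_parent hy
    obtain ⟨P, hc, hu, hwP, hz, hin, hw1, hu1⟩ := ih w hw
    obtain ⟨h1, h2⟩ := mem_sdiff.1 hy
    have hPb : ∀ z ∈ P, z ∈ bl H u (i + 1) := by
      intro z hzP
      rcases hz z hzP with rfl | h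
      · exact (mem_sdiff.1 hw).1
      · exact mem_bl_succ.2 (Or.inr (Or.inl h))
    have hyP : y ∉ P := fun h => h2 (hPb y h)
    refine ⟨insert y P, ?_, by simp [hu], by simp, ?_, ?_, ?_, ?_⟩
    · rw [card_insert_of_notMem hyP]; omega
    · intro z hzP
      rcases mem_insert.1 hzP with rfl | h
      · exact Or.inl rfl
      · exact Or.inr (hPb z h)
    · intro z hzP hzu hzy
      have hzP' := (mem_insert.1 hzP).resolve_left hzy
      by_cases hzw : z = w
      · subst hzw
        obtain ⟨a, ha, hza⟩ := hw1 hzu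
        exact ⟨a, mem_insert_of_mem ha, y, mem_insert_self _ _,
          fun h => hyP (h ▸ ha), hza, hyw.symm⟩
      · obtain ⟨a, ha, b, hb, h⟩ := hin z hzP' hzu hzw
        exact ⟨a, mem_insert_of_mem ha, b, mem_insert_of_mem hb, h⟩
    · intro _; exact ⟨w, mem_insert_of_mem hwP, hyw⟩
    · intro _
      by_cases hwu : w = u
      · subst hwu; exact ⟨y, mem_insert_self _ _, hyw.symm⟩
      · obtain ⟨a, ha, h⟩ := hu1 hwu
        exact ⟨a, mem_insert_of_mem ha, h⟩

theorem card_union_common {P Q : Finset V} {u : V} (h1 : u ∈ P) (h2 : u ∈ Q) :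
    (P ∪ Q).card + 1 ≤ P.card + Q.card := by
  rw [← card_union_add_card_inter]
  have : 0 < (P ∩ Q).card := card_pos.2 ⟨u, mem_inter.2 ⟨h1, h2⟩⟩
  omega

/-- Two parents give a short core. -/
theorem core_two_parents {H : SimpleGraph V} {u x y z : V} {i : ℕ} (hx : x ∈ ly H u (i + 1))
    (hy : y ∈ ly H u i) (hz : z ∈ ly H u i) (hyz : y ≠ z) (h1 : H.Adj x y) (h2 : H.Adj x z) :
    ∃ C, Core H C ∧ C.card ≤ 2 * i + 2 := by
  obtain ⟨P, pc, pu, py, pz, pin, py1, pu1⟩ := ly_path i y hy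
  obtain ⟨Q, qc, qu, qy, qz, qin, qy1, qu1⟩ := ly_path i z hz
  have hxb := (mem_sdiff.1 hx).2
  have hbP : ∀ w ∈ P, w ∈ bl H u (i + 1) := by
    intro w hw
    rcases pz w hw with rfl | h
    · exact (mem_sdiff.1 hy).1
    · exact mem_bl_succ.2 (Or.inr (Or.inl h))
  have hbQ : ∀ w ∈ Q, w ∈ bl H u (i + 1) := by
    intro w hw
    rcases qz w hw with rfl | h
    · exact (mem_sdiff.1 hz).1
    · exact mem_bl_succ.2 (Or.inr (Or.inl h))
  have hxP : x ∉ P := fun h => hxb (hbP x h)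
  have hxQ : x ∉ Q := fun h => hxb (hbQ x h)
  have sP : ∀ {w}, w ∈ P → w ∈ insert x (P ∪ Q) := fun h =>
    mem_insert_of_mem (mem_union_left _ h)
  have sQ : ∀ {w}, w ∈ Q → w ∈ insert x (P ∪ Q) := fun h =>
    mem_insert_of_mem (mem_union_right _ h)
  obtain ⟨B, hB, hBc⟩ := core_of_exception (G := H) _ (insert x (P ∪ Q)) u le_rfl (sP pu)
    (by
      by_cases hyu : y = u
      · subst hyu; exact ⟨x, mem_insert_self _ _, h1.symm⟩
      · obtain ⟨a, ha, h⟩ := pu1 hyu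
        exact ⟨a, sP ha, h⟩)
    (by
      intro w hw hwu
      rcases mem_insert.1 hw with rfl | hw
      · exact ⟨y, sP py, z, sQ qy, hyz, h1, h2⟩
      rcases mem_union.1 hw with hw | hw
      · by_cases hwy : w = y
        · subst hwy
          obtain ⟨a, ha, h⟩ := py1 hwu
          exact ⟨a, sP ha, x, mem_insert_self _ _, fun e => hxP (e ▸ ha), h, h1.symm⟩
        · obtain ⟨a, ha, b, hb, h⟩ := pin w hw hwu hwy
          exact ⟨a, sP ha, b, sP hb, h⟩
      · by_cases hwz : w = z
        · subst hwz
          obtain ⟨a, ha, h⟩ := qy1 hwu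
          exact ⟨a, sQ ha, x, mem_insert_self _ _, fun e => hxQ (e ▸ ha), h, h2.symm⟩
        · obtain ⟨a, ha, b, hb, h⟩ := qin w hw hwu hwz
          exact ⟨a, sQ ha, b, sQ hb, h⟩)
  refine ⟨B, hBc, (card_le_card hB).trans ((card_insert_le _ _).trans ?_)⟩
  have := card_union_common pu qu
  omega

/-- An edge inside a layer gives a short core. -/
theorem core_layer_edge {H : SimpleGraph V} {u y z : V} {i : ℕ}
    (hy : y ∈ ly H u (i + 1)) (hz : z ∈ ly H u (i + 1)) (hyz : H.Adj y z) :
    ∃ C, Core H C ∧ C.card ≤ 2 * i + 3 := by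
  obtain ⟨P, pc, pu, py, pz, pin, py1, pu1⟩ := ly_path _ y hy
  obtain ⟨Q, qc, qu, qy, qz, qin, qy1, qu1⟩ := ly_path _ z hz
  have hyb := (mem_sdiff.1 hy).2
  have hzb := (mem_sdiff.1 hz).2
  have hzP : z ∉ P := fun h => (pz z h).elim (fun e => hyz.ne e.symm) hzb
  have hyQ : y ∉ Q := fun h => (qz y h).elim (fun e => hyz.ne e) hyb
  have hyu : y ≠ u := by rintro rfl; exact hyb (u_mem_bl _)
  have sP : ∀ {w}, w ∈ P → w ∈ P ∪ Q := fun h => mem_union_left _ h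
  have sQ : ∀ {w}, w ∈ Q → w ∈ P ∪ Q := fun h => mem_union_right _ h
  obtain ⟨B, hB, hBc⟩ := core_of_exception (G := H) _ (P ∪ Q) u le_rfl (sP pu)
    (by
      obtain ⟨a, ha, h⟩ := pu1 hyu
      exact ⟨a, sP ha, h⟩)
    (by
      intro w hw hwu
      rcases mem_union.1 hw with hw | hw
      · by_cases hwy : w = y
        · subst hwy
          obtain ⟨a, ha, h⟩ := py1 hwu
          exact ⟨a, sP ha, z, sQ qy, fun e => hzP (e ▸ ha), h, hyz⟩
        · obtain ⟨a, ha, b, hb, h⟩ := pin w hw hwu hwy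
          exact ⟨a, sP ha, b, sP hb, h⟩
      · by_cases hwz : w = z
        · subst hwz
          obtain ⟨a, ha, h⟩ := qy1 hwu
          exact ⟨a, sQ ha, y, sP py, fun e => hyQ (e ▸ ha), h, hyz.symm⟩
        · obtain ⟨a, ha, b, hb, h⟩ := qin w hw hwu hwz
          exact ⟨a, sQ ha, b, sQ hb, h⟩)
  refine ⟨B, hBc, (card_le_card hB).trans ?_⟩
  have := card_union_common pu qu
  omega

theorem bl_mono {H : SimpleGraph V} {u : V} (i : ℕ) : bl H u i ⊆ bl H u (i + 1) :=
  fun _ h => mem_bl_succ.2 (Or.inr (Or.inl h))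

theorem card_bl_succ {H : SimpleGraph V} {u : V} (i : ℕ) :
    (bl H u (i + 1)).card = (bl H u i).card + (ly H u i).card := by
  have := card_sdiff_add_card_eq_card (bl_mono (H := H) (u := u) i)
  unfold ly; omega

theorem bl_nonisolated {H : SimpleGraph V} {u : V} (hu : dg H u ≠ 0) (i : ℕ) :
    ∀ x ∈ bl H u i, dg H x ≠ 0 := by
  induction i with
  | zero => simp [bl]
  | succ i ih =>
    intro x hx
    rcases mem_bl_succ.1 hx with rfl | h | ⟨y, hy, h⟩
    · exact hu
    · exact ih x h
    · exact fun h0 => dg_eq_zero.1 h0 y h.symm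

/-- Moore bound: minimum degree 3 and no core with at most `2r+1` vertices. -/
theorem moore {H : SimpleGraph V} (hH : ∀ x, dg H x = 0 ∨ 3 ≤ dg H x) (u : V) (hu : dg H u ≠ 0)
    (r : ℕ) (hno : ∀ C, Core H C → 2 * r + 4 ≤ C.card) :
    3 * 2 ^ (r + 1) ≤ (univ.filter fun x => dg H x ≠ 0).card + 1 := by
  -- every vertex in layer `i+1` has two children
  have hch : ∀ i, i ≤ r → ∀ x ∈ ly H u (i + 1), 2 ≤ (nb H x ∩ ly H u (i + 2)).card := by
    intro i hi x hx
    have hd : 3 ≤ dg H x := (hH x).resolve_left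
      (bl_nonisolated hu (i + 2) x (mem_sdiff.1 hx).1)
    have hsub : nb H x ⊆ (nb H x ∩ ly H u i) ∪ (nb H x ∩ ly H u (i + 2)) := by
      intro y hy
      have hxy := mem_nb.1 hy
      rcases ly_nbr hx hxy with h | h | h
      · simp [hxy, h]
      · obtain ⟨C, hC, hc⟩ := core_layer_edge hx h hxy
        have := hno C hC
        omega
      · simp [hxy, h]
    have h1 : (nb H x ∩ ly H u i).card ≤ 1 := by
      by_contra hcon
      obtain ⟨a, ha, b, hb, hab⟩ := one_lt_card.1 (not_le.1 hcon)
      simp only [mem_inter, mem_nb] at ha hb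
      obtain ⟨C, hC, hc⟩ := core_two_parents hx ha.2 hb.2 hab ha.1 hb.1
      have := hno C hC
      omega
    have h2 := (card_le_card hsub).trans (card_union_le _ _)
    unfold dg at hd
    omega
  have hl1 : 3 ≤ (ly H u 1).card := by
    refine ((hH u).resolve_left hu).trans (card_le_card ?_)
    intro y hy
    have hy := mem_nb.1 hy
    refine mem_sdiff.2 ⟨mem_bl_succ.2 (Or.inr (Or.inr ⟨u, u_mem_bl 0, hy⟩)), ?_⟩
    simp [bl, hy.ne']
  have hgrow : ∀ i, i < r → 2 * (ly H u (i + 1)).card ≤ (ly H u (i + 2)).card := by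
    intro i hi
    have := card_mul_le_card_mul (s := ly H u (i + 1)) (t := ly H u (i + 2)) H.Adj (m := 2) (n := 1)
      (by
        intro x hx
        refine (hch i hi.le x hx).trans (card_le_card ?_)
        intro y hy
        simpa [mem_bipartiteAbove, and_comm] using hy)
      (by
        intro x hx
        by_contra hcon
        obtain ⟨a, ha, b, hb, hab⟩ := one_lt_card.1 (not_le.1 hcon)
        rw [mem_bipartiteBelow] at ha hb
        obtain ⟨C, hC, hc⟩ := core_two_parents hx ha.1 hb.1 hab ha.2.symm hb.2.symm
        have := hno C hC
        omega)
    omega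
  have hmain : ∀ i, i ≤ r → 3 * 2 ^ i ≤ (ly H u (i + 1)).card ∧
      3 * 2 ^ (i + 1) ≤ (bl H u (i + 2)).card + 2 := by
    intro i
    induction i with
    | zero =>
      intro _
      have h1 : (bl H u 2).card = (bl H u 1).card + (ly H u 1).card := card_bl_succ 1
      have h2 : (bl H u 1).card = (bl H u 0).card + (ly H u 0).card := card_bl_succ 0
      have h3 : (ly H u 0).card = 1 := by rw [ly_zero]; simp
      simp only [zero_add, pow_zero, pow_one] at *
      omega
    | succ i ih =>
      intro hi
      obtain ⟨a, b⟩ := ih (by omega)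
      have h1 := hgrow i (by omega)
      have h2 := card_bl_succ (H := H) (u := u) (i + 2)
      rw [pow_succ] at b
      rw [show i + 1 + 1 = i + 2 from rfl, show i + 1 + 2 = i + 2 + 1 from rfl, pow_succ 2 (i + 1),
        pow_succ]
      omega
  obtain ⟨h1, h2⟩ := hmain r le_rfl
  have hne : (ly H u (r + 1)).Nonempty := by
    rw [← card_pos]
    have : 0 < 2 ^ r := by positivity
    omega
  obtain ⟨x, hx⟩ := hne
  have h3 := (hch r le_rfl x hx).trans (card_le_card inter_subset_right)
  have h4 := card_bl_succ (H := H) (u := u) (r + 2)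
  have h5 : (bl H u (r + 3)).card ≤ (univ.filter fun x => dg H x ≠ 0).card :=
    card_le_card fun y hy => by simpa using bl_nonisolated hu _ y hy
  rw [show r + 3 = r + 2 + 1 from rfl] at h5
  omega

/-! ### suppressing a vertex of degree two -/

def supp2 (H : SimpleGraph V) (v a b : V) (hab : a ≠ b) : SimpleGraph V where
  Adj x y := (H.Adj x y ∧ x ≠ v ∧ y ≠ v) ∨ (x = a ∧ y = b) ∨ (x = b ∧ y = a)
  symm := ⟨by
    rintro x y (h | h | h)
    · exact Or.inl ⟨h.1.symm, h.2.2, h.2.1⟩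
    · exact Or.inr (Or.inr ⟨h.2, h.1⟩)
    · exact Or.inr (Or.inl ⟨h.2, h.1⟩)⟩
  loopless := ⟨by
    rintro x (h | h | h)
    · exact h.1.ne rfl
    · exact hab (h.1.symm.trans h.2)
    · exact hab (h.2.symm.trans h.1)⟩

theorem dg_supp2 {H : SimpleGraph V} {v a b : V} (hab : a ≠ b) (hn : nb H v = {a, b})
    (hnadj : ¬ H.Adj a b) (x : V) :
    dg (supp2 H v a b hab) x = if x = v then 0 else dg H x := by
  have hva : H.Adj v a := by rw [← mem_nb, hn]; simp
  have hvb : H.Adj v b := by rw [← mem_nb, hn]; simp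
  have hv : ∀ y, H.Adj v y → y = a ∨ y = b := by
    intro y hy; rw [← mem_nb, hn] at hy; simpa using hy
  split_ifs with hx
  · subst hx
    rw [dg_eq_zero]
    rintro y (h | h | h)
    · exact h.2.1 rfl
    · exact hva.ne h.1
    · exact hvb.ne h.1
  · by_cases hxa : x = a
    · subst hxa
      have : nb (supp2 H v x b hab) x = insert b ((nb H x).erase v) := by
        ext y
        simp only [supp2, mem_nb, mem_insert, mem_erase]
        grind
      rw [dg, this, card_insert_of_notMem, card_erase_of_mem, dg]
      · have : 0 < (nb H x).card := card_pos.2 ⟨v, by simpa using hva.symm⟩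
        omega
      · simpa using hva.symm
      · simp [hnadj]
    · by_cases hxb : x = b
      · subst hxb
        have : nb (supp2 H v a x hab) x = insert a ((nb H x).erase v) := by
          ext y
          simp only [supp2, mem_nb, mem_insert, mem_erase]
          grind
        rw [dg, this, card_insert_of_notMem, card_erase_of_mem, dg]
        · have : 0 < (nb H x).card := card_pos.2 ⟨v, by simpa using hvb.symm⟩
          omega
        · simpa using hvb.symm
        · simp only [mem_erase, mem_nb, not_and]
          exact fun _ h => hnadj h.symm
      · rw [dg, dg]
        congr 1
        ext y
        simp only [supp2, mem_nb]
        constructor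
        · rintro (h | h | h)
          · exact h.1
          · exact absurd h.1 hxa
          · exact absurd h.1 hxb
        · intro h
          refine Or.inl ⟨h, hx, ?_⟩
          rintro rfl
          rcases hv x h.symm with h | h
          · exact hxa h
          · exact hxb h

theorem Phi_supp2 {H : SimpleGraph V} {v a b : V} (hab : a ≠ b) (hn : nb H v = {a, b})
    (hnadj : ¬ H.Adj a b) :
    Phi (supp2 H v a b hab) = Phi H := by
  apply sum_congr rfl
  intro x _
  rw [dg_supp2 hab hn hnadj]
  split_ifs with h
  · subst h
    have : dg H x = 2 := by rw [dg, hn, card_pair hab]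
    rw [this]; rfl
  · rfl

theorem M_supp2 {H : SimpleGraph V} {v a b : V} (hab : a ≠ b) (hn : nb H v = {a, b})
    (hnadj : ¬ H.Adj a b) :
    M (supp2 H v a b hab) < M H := by
  apply M_lt (x := v)
  · intro x; rw [dg_supp2 hab hn hnadj]; split_ifs <;> omega
  · rw [dg_supp2 hab hn hnadj, if_pos rfl, dg, hn, card_pair hab]; omega

theorem Pack_supp2 {H : SimpleGraph V} {v a b : V} (hab : a ≠ b) (hn : nb H v = {a, b})
    (hnadj : ¬ H.Adj a b) {k : ℕ} (h : Pack (supp2 H v a b hab) k) : Pack H k := by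
  have hva : H.Adj v a := by rw [← mem_nb, hn]; simp
  have hvb : H.Adj v b := by rw [← mem_nb, hn]; simp
  obtain ⟨f, hf, hd⟩ := h
  have hvf : ∀ i, v ∉ f i := by
    intro i hi
    obtain ⟨y, -, z, -, -, h1, -⟩ := (hf i).2 v hi
    have := dg_supp2 hab hn hnadj v
    rw [if_pos rfl, dg_eq_zero] at this
    exact this y h1
  refine ⟨fun i => if a ∈ f i ∧ b ∈ f i then insert v (f i) else f i, ?_, ?_⟩
  · intro i
    dsimp only
    split_ifs with hi
    · refine ⟨⟨v, mem_insert_self _ _⟩, ?_⟩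
      intro x hx
      rcases mem_insert.1 hx with rfl | hx
      · exact ⟨a, mem_insert_of_mem hi.1, b, mem_insert_of_mem hi.2, hab, hva, hvb⟩
      · obtain ⟨y, hy, z, hz, hyz, h1, h2⟩ := (hf i).2 x hx
        have hvi := hvf i
        -- replace the other end of the new edge by `v`
        have key : ∀ y ∈ f i, (supp2 H v a b hab).Adj x y → H.Adj x y ∨
            (H.Adj x v ∧ ((x = a ∧ y = b) ∨ (x = b ∧ y = a))) := by
          rintro y hy (h | h | h)
          · exact Or.inl h.1
          · exact Or.inr ⟨by rw [h.1]; exact hva.symm, Or.inl h⟩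
          · exact Or.inr ⟨by rw [h.1]; exact hvb.symm, Or.inr h⟩
        rcases key y hy h1 with k1 | k1 <;> rcases key z hz h2 with k2 | k2
        · exact ⟨y, mem_insert_of_mem hy, z, mem_insert_of_mem hz, hyz, k1, k2⟩
        · exact ⟨y, mem_insert_of_mem hy, v, mem_insert_self _ _, fun e => hvi (e ▸ hy), k1, k2.1⟩
        · exact ⟨v, mem_insert_self _ _, z, mem_insert_of_mem hz, fun e => hvi (e ▸ hz), k1.1, k2⟩
        · exfalso
          grind
    · refine ⟨(hf i).1, fun x hx => ?_⟩
      obtain ⟨y, hy, z, hz, hyz, h1, h2⟩ := (hf i).2 x hx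
      have key : ∀ y ∈ f i, (supp2 H v a b hab).Adj x y → H.Adj x y := by
        rintro y hy (h | h | h)
        · exact h.1
        · exact absurd ⟨h.1 ▸ hx, h.2 ▸ hy⟩ hi
        · exact absurd ⟨h.2 ▸ hy, h.1 ▸ hx⟩ hi
      exact ⟨y, hy, z, hz, hyz, key y hy h1, key z hz h2⟩
  · intro i j hij
    have hdij := disjoint_left.1 (hd i j hij)
    have hvi := hvf i
    have hvj := hvf j
    rw [disjoint_left]
    dsimp only
    intro x hx hx'
    split_ifs at hx hx' with h1 h2 h2 <;> grind

/-! ### deleting an edge -/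

theorem dg_delEdge_ge {H : SimpleGraph V} (x y : V) (z : V) :
    dg H z ≤ dg (H.deleteEdges {s(x, y)}) z + (if z = x ∨ z = y then 1 else 0) := by
  have hsub : nb H z ⊆ nb (H.deleteEdges {s(x, y)}) z ∪
      (if z = x then {y} else if z = y then {x} else ∅) := by
    intro w hw
    simp only [mem_nb] at hw
    simp only [mem_union, mem_nb, SimpleGraph.deleteEdges_adj, Set.mem_singleton_iff, Sym2.eq_iff]
    split_ifs <;> simp <;> grind
  refine (card_le_card hsub).trans ((card_union_le _ _).trans ?_)
  rw [dg]
  split_ifs <;> simp <;> grind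

theorem Phi_delEdge {H : SimpleGraph V} {x y : V} (hxy : x ≠ y) :
    Phi H - 2 ≤ Phi (H.deleteEdges {s(x, y)}) := by
  have h1 : ∀ z, phi (dg H z) - (if z = x ∨ z = y then 1 else 0) ≤
      phi (dg (H.deleteEdges {s(x, y)}) z) := by
    intro z
    have h1 := dg_delEdge_ge (H := H) x y z
    have h2 := dg_mono (SimpleGraph.deleteEdges_le (G := H) {s(x, y)}) z
    unfold phi
    split_ifs at * <;> omega
  have h2 := sum_le_sum (s := univ) fun z _ => h1 z
  rw [sum_sub_distrib] at h2
  have h3 : ∑ z : V, (if z = x ∨ z = y then (1 : ℤ) else 0) = 2 := by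
    rw [← sum_filter]
    have : (univ.filter fun z => z = x ∨ z = y) = {x, y} := by ext; simp
    rw [this, sum_pair hxy]; norm_num
  rw [h3] at h2
  exact h2

theorem M_delEdge {H : SimpleGraph V} {x y : V} (hxy : H.Adj x y) :
    M (H.deleteEdges {s(x, y)}) < M H := by
  apply M_lt (x := x)
  · exact dg_mono (SimpleGraph.deleteEdges_le _)
  · apply card_lt_card
    rw [ssubset_iff_of_subset]
    · exact ⟨y, by simpa using hxy, by simp⟩
    · intro z hz
      simp only [mem_nb] at *
      exact SimpleGraph.deleteEdges_le _ hz

/-! ### packing in subcubic graphs -/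

theorem exists_edge_of_Phi {H : SimpleGraph V} (h : 1 ≤ Phi H) : ∃ x y, H.Adj x y := by
  by_contra hc
  push Not at hc
  have : Phi H = 0 := sum_eq_zero fun x _ => by
    rw [dg_eq_zero.2 (hc x)]; rfl
  omega

theorem pack_one {H : SimpleGraph V} (h : ∃ A, Core H A) : Pack H 1 := by
  obtain ⟨A, hA⟩ := h
  exact ⟨fun _ => A, fun _ => hA, fun i j hij => absurd (Subsingleton.elim i j) hij⟩

theorem pack_pos {H : SimpleGraph V} (he : ∃ x y, H.Adj x y) (h : -1 ≤ Phi H) : Pack H 1 :=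
  pack_one (base _ H le_rfl he h)

/-- In a cubic graph with potential at least 9 the complement of a core of size
at most 5 still contains a core. -/
theorem five_core {H : SimpleGraph V} (h3 : ∀ x, dg H x = 0 ∨ dg H x = 3) (hP : 9 ≤ Phi H)
    {C : Finset V} (hC : Core H C) (hc : C.card ≤ 5) : Pack (del H C) 1 := by
  have hle : ∀ x, dg H x ≤ 3 := fun x => by rcases h3 x with h | h <;> omega
  have h1 := Phi_del_core hle hC
  have h2 : (C.filter fun c => dg H c = 3).card ≤ 5 := (card_filter_le _ _).trans hc
  refine pack_pos ?_ (by omega)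
  by_contra hcon
  push Not at hcon
  have e0 : ∀ x ∉ C, (nb H x ∩ C).card = dg H x := by
    intro x hx
    have := dg_del H hx
    rw [dg_eq_zero.2 (hcon x)] at this
    omega
  have e1 : ∑ x ∈ Cᶜ, dg H x ≤ 5 := by
    rw [← sum_congr rfl (fun x hx => e0 x (by simpa using hx)), sum_cut]
    calc ∑ c ∈ C, (nb H c \ C).card ≤ ∑ c ∈ C, 1 := sum_le_sum fun c hcC => by
          have := dg_core hC hcC
          have := hle c
          omega
      _ ≤ 5 := by simpa using hc
  have e2 : Phi H = ∑ x ∈ C, phi (dg H x) + ∑ x ∈ Cᶜ, phi (dg H x) :=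
    (sum_add_sum_compl C _).symm
  have e3 : ∑ x ∈ C, phi (dg H x) ≤ 5 := by
    calc ∑ x ∈ C, phi (dg H x) ≤ ∑ x ∈ C, 1 := sum_le_sum fun c _ => by
          rcases h3 c with h | h <;> rw [h] <;> decide
      _ ≤ 5 := by simpa using hc
  have e4 : 3 * ∑ x ∈ Cᶜ, phi (dg H x) ≤ ((∑ x ∈ Cᶜ, dg H x : ℕ) : ℤ) := by
    rw [mul_sum, Nat.cast_sum]
    exact sum_le_sum fun c _ => by
      rcases h3 c with h | h <;> rw [h] <;> decide
  omega

theorem packP (k : ℕ) (hk : 1 ≤ k) : ∀ H : SimpleGraph V, (∀ x, dg H x ≤ 3) →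
    12 * (k : ℤ) ^ 2 - 28 * k + 17 ≤ Phi H → Pack H k := by
  induction k, hk using Nat.le_induction with
  | base =>
    intro H _ hP
    norm_num at hP
    exact pack_pos (exists_edge_of_Phi (by omega)) (by omega)
  | succ k hk IH =>
    suffices h : ∀ n, ∀ H : SimpleGraph V, M H ≤ n → (∀ x, dg H x ≤ 3) →
        12 * (k : ℤ) ^ 2 - 4 * k + 1 ≤ Phi H → Pack H (k + 1) by
      intro H hH hP
      refine h _ H le_rfl hH (le_trans (le_of_eq ?_) hP)
      push_cast; ring
    have hk1 : (1 : ℤ) ≤ k := by exact_mod_cast hk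
    have hkk : (k : ℤ) ≤ (k : ℤ) ^ 2 := by nlinarith
    intro n
    induction n with
    | zero =>
      intro H hM _ hP
      obtain ⟨x, y, hxy⟩ := exists_edge_of_Phi (H := H) (by linarith)
      have : dg H x = 0 := by
        have := single_le_sum (f := dg H) (fun _ _ => Nat.zero_le _) (mem_univ x)
        unfold M at hM; omega
      exact absurd hxy (dg_eq_zero.1 this y)
    | succ n ih =>
      intro H hM hH hP
      by_cases hl : ∃ v, dg H v = 1
      · obtain ⟨v, hv⟩ := hl
        refine (ih (del H {v}) ?_ (fun x => (dg_mono (del_le _ _) x).trans (hH x))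
          (hP.trans (Phi_del_leaf hv))).mono (del_le _ _)
        have := M_del_lt (H := H) (mem_singleton_self v) (by omega); omega
      push Not at hl
      by_cases h2 : ∃ v, dg H v = 2
      · obtain ⟨v, hv⟩ := h2
        obtain ⟨a, b, hab, hn⟩ := card_eq_two.1 (show (nb H v).card = 2 from hv)
        have hva : H.Adj v a := by rw [← mem_nb, hn]; simp
        have hvb : H.Adj v b := by rw [← mem_nb, hn]; simp
        by_cases hadj : H.Adj a b
        · have hC : Core H {v, a, b} := by
            refine ⟨⟨v, by simp⟩, ?_⟩
            intro x hx
            simp only [mem_insert, mem_singleton] at hx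
            rcases hx with rfl | rfl | rfl
            · exact ⟨a, by simp, b, by simp, hab, hva, hvb⟩
            · exact ⟨v, by simp, b, by simp, hvb.ne, hva.symm, hadj⟩
            · exact ⟨v, by simp, a, by simp, hva.ne, hvb.symm, hadj.symm⟩
          have h5 := Phi_del_core hH hC
          have h6 : (({v, a, b} : Finset V).filter fun c => dg H c = 3).card ≤ 2 := by
            rw [← card_pair hab]
            apply card_le_card
            intro x hx
            simp only [mem_filter, mem_insert, mem_singleton] at hx ⊢
            rcases hx with ⟨rfl | h, h'⟩
            · omega
            · exact h
          have h7 : (((({v, a, b} : Finset V).filter fun c => dg H c = 3).card : ℕ) : ℤ) ≤ 2 := by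
            exact_mod_cast h6
          exact Pack.insert hC (IH _ (fun x => (dg_mono (del_le _ _) x).trans (hH x)) (by linarith))
        · refine Pack_supp2 hab hn hadj (ih _ ?_ ?_ ?_)
          · have := M_supp2 hab hn hadj; omega
          · intro x; rw [dg_supp2 hab hn hadj]; split_ifs
            · omega
            · exact hH x
          · rw [Phi_supp2 hab hn hadj]; exact hP
      push Not at h2
      have h3 : ∀ x, dg H x = 0 ∨ dg H x = 3 := by
        intro x
        have := hl x; have := h2 x; have := hH x
        omega
      obtain ⟨u, y, huy⟩ := exists_edge_of_Phi (H := H) (by linarith)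
      by_cases hbig : 12 * (k : ℤ) ^ 2 - 4 * k + 3 ≤ Phi H
      · refine (ih (H.deleteEdges {s(u, y)}) ?_ (fun x =>
          (dg_mono (SimpleGraph.deleteEdges_le _) x).trans (hH x)) ?_).mono
            (SimpleGraph.deleteEdges_le _)
        · have := M_delEdge huy; omega
        · have := Phi_delEdge (H := H) huy.ne; linarith
      have hu : dg H u ≠ 0 := fun h0 => dg_eq_zero.1 h0 y huy
      have hN : ((univ.filter fun x => dg H x ≠ 0).card : ℤ) = Phi H := by
        rw [card_filter, Nat.cast_sum]
        refine sum_congr rfl fun x _ => ?_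
        rcases h3 x with h | h <;> rw [h] <;> rfl
      have hmoore := moore (H := H) (fun x => (h3 x).imp id (fun h => h.ge)) u hu
      rcases hk.eq_or_lt with rfl | hk2
      · by_cases hcore : ∃ C, Core H C ∧ C.card ≤ 5
        · obtain ⟨C, hC, hc⟩ := hcore
          exact Pack.insert hC (five_core h3 (by norm_num at hP; exact hP) hC hc)
        · push Not at hcore
          have := hmoore 1 (fun C hC => hcore C hC)
          rw [show 3 * 2 ^ (1 + 1) = 12 from rfl] at this
          norm_num at hbig
          omega
      · by_cases hcore : ∃ C, Core H C ∧ C.card ≤ 6 * k + 3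
        · obtain ⟨C, hC, hc⟩ := hcore
          have h5 := Phi_del_core hH hC
          have h6 : (C.filter fun c => dg H c = 3).card ≤ 6 * k + 3 := (card_filter_le _ _).trans hc
          have h7 : ((C.filter fun c => dg H c = 3).card : ℤ) ≤ 6 * k + 3 := by exact_mod_cast h6
          have h8 : (2 : ℤ) ≤ k := by exact_mod_cast hk2
          exact Pack.insert hC (IH _ (fun x => (dg_mono (del_le _ _) x).trans (hH x)) (by linarith))
        · exfalso
          push Not at hcore
          have h9 := hmoore (3 * k) (fun C hC => by have := hcore C hC; omega)
          have h10 : k < 2 ^ k := Nat.lt_two_pow_self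
          have h11 : (2 : ℕ) ^ (3 * k + 1) = 2 * (2 ^ k * (2 ^ k * 2 ^ k)) := by ring
          have h12 : k * k ≤ 2 ^ k * 2 ^ k := Nat.mul_le_mul h10.le h10.le
          have h13 : 2 * (k * k) ≤ 2 ^ k * (2 ^ k * 2 ^ k) := Nat.mul_le_mul (by omega) h12
          have h14 : 12 * (k * k) ≤ (univ.filter fun x => dg H x ≠ 0).card + 1 := by
            rw [h11] at h9; omega
          have h15 : 12 * ((k : ℤ) * k) ≤ Phi H + 1 := by rw [← hN]; exact_mod_cast h14
          nlinarith

/-! ### the maximal subgraph -/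

def Good (G H : SimpleGraph V) : Prop := H ≤ G ∧ ∀ x, dg H x = 0 ∨ dg H x = 2 ∨ dg H x = 3

theorem exists_max (G : SimpleGraph V) : ∃ H, Maximal (Good G) H := by
  have := Set.Finite.exists_maximal (s := {H | Good G H}) (Set.toFinite _)
    ⟨⊥, bot_le, fun x => Or.inl (dg_eq_zero.2 (by simp))⟩
  exact this

theorem dg_sup_le (H P : SimpleGraph V) (x : V) : dg (H ⊔ P) x ≤ dg H x + dg P x := by
  have : nb (H ⊔ P) x = nb H x ∪ nb P x := by ext; simp
  rw [dg, this]
  exact card_union_le _ _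

theorem ext_le {G H P : SimpleGraph V} (hH : Maximal (Good G) H) (hP : P ≤ G)
    (h : ∀ x, dg P x = 0 ∨ (dg H x = 0 ∧ dg P x = 2) ∨ (dg H x = 2 ∧ dg P x ≤ 1)) : P ≤ H := by
  have hg : Good G (H ⊔ P) := by
    refine ⟨sup_le hH.prop.1 hP, fun x => ?_⟩
    have h1 := dg_sup_le H P x
    have h2 := dg_mono (le_sup_left : H ≤ H ⊔ P) x
    have h3 := dg_mono (le_sup_right : P ≤ H ⊔ P) x
    have h4 := hH.prop.2 x
    have h5 := h x
    omega
  exact le_sup_right.trans (hH.le_of_ge hg le_sup_left)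

theorem dg_sub {G : SimpleGraph V} (S : G.Subgraph) (x : V) :
    dg S.spanningCoe x = (S.neighborSet x).ncard := by
  rw [dg, ← Set.ncard_coe_finset]
  congr 1
  ext y; simp

theorem edge_in {G H : SimpleGraph V} (hH : Maximal (Good G) H) {x y : V} (hx : dg H x = 2)
    (hy : dg H y = 2) (h : G.Adj x y) : H.Adj x y := by
  have : SimpleGraph.edge x y ≤ H := by
    apply ext_le hH
    · rw [SimpleGraph.edge_le_iff]; exact Or.inr h
    · intro z
      have hz : nb (SimpleGraph.edge x y) z ⊆ if z = x then {y} else if z = y then {x} else ∅ := by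
        intro w hw
        rw [mem_nb, SimpleGraph.edge_adj] at hw
        split_ifs <;> simp <;> grind
      have hz' := card_le_card hz
      rw [← dg] at hz'
      split_ifs at hz' with h1 h2
      · subst h1; simp at hz'; omega
      · subst h2; simp at hz'; omega
      · simp at hz'; omega
  apply this
  rw [SimpleGraph.edge_adj]
  exact ⟨Or.inl ⟨rfl, rfl⟩, h.ne⟩

theorem no_core_outside {G H : SimpleGraph V} (hH : Maximal (Good G) H) {A : Finset V}
    (hA : Core G A) : ∃ x ∈ A, dg H x ≠ 0 := by
  by_contra hcon
  push Not at hcon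
  obtain ⟨v, c, hc, hs⟩ := core_cycle hA
  have : c.toSubgraph.spanningCoe ≤ H := by
    apply ext_le hH (SimpleGraph.Subgraph.spanningCoe_le _)
    intro x
    by_cases hx : x ∈ c.support
    · right; left
      exact ⟨hcon x (hs x hx), by rw [dg_sub, hc.ncard_neighborSet_toSubgraph_eq_two hx]⟩
    · left
      rw [dg_eq_zero]
      intro y hy
      exact hx (SimpleGraph.Walk.mem_support_of_adj_toSubgraph hy)
  obtain ⟨y, -, z, -, -, h1, -⟩ := (cycle_core hc).2 v (by simp)
  have h0 := dg_eq_zero.1 (hcon v (hs v (by simp)))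
  have h2 := hc.ncard_neighborSet_toSubgraph_eq_two (v := v) (by simp)
  obtain ⟨y, z, hne, he⟩ := Set.ncard_eq_two.1 h2
  have hy : y ∈ c.toSubgraph.neighborSet v := by rw [he]; simp
  exact h0 y (this hy)

/-- The part of `G` outside the support of `H`. -/
def out (G H : SimpleGraph V) : SimpleGraph V where
  Adj x y := G.Adj x y ∧ dg H x = 0 ∧ dg H y = 0
  symm := ⟨fun _ _ h => ⟨h.1.symm, h.2.2, h.2.1⟩⟩
  loopless := ⟨fun _ h => h.1.ne rfl⟩

theorem out_le (G H : SimpleGraph V) : out G H ≤ G := fun _ _ h => h.1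

theorem out_reach {G H : SimpleGraph V} {x y : V} (h : (out G H).Reachable x y) (hx : dg H x = 0) :
    dg H y = 0 := by
  obtain ⟨p⟩ := h
  induction p with
  | nil => exact hx
  | cons h _ ih => exact ih h.2.2

theorem out_path {G H : SimpleGraph V} {x y : V} (h : (out G H).Reachable x y) :
    ∃ p : G.Walk x y, p.IsPath ∧ ∀ z ∈ p.support, (out G H).Reachable x z := by
  obtain ⟨p, hp⟩ := h.exists_isPath
  refine ⟨p.mapLe (out_le G H), ?_, ?_⟩
  · exact hp.mapLe _
  · intro z hz
    rw [SimpleGraph.Walk.support_mapLe_eq_support] at hz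
    exact (p.takeUntil z hz).reachable

theorem attach {G H : SimpleGraph V} (hH : Maximal (Good G) H) {a b s t : V} (hab : a ≠ b)
    (ha : dg H a = 2) (hb : dg H b = 2) (hs : dg H s = 0) (hr : (out G H).Reachable s t)
    (has : G.Adj a s) (hbt : G.Adj b t) : False := by
  obtain ⟨p, hp, hps⟩ := out_path hr
  have hp0 : ∀ z ∈ p.support, dg H z = 0 := fun z hz => out_reach (hps z hz) hs
  have hap : a ∉ p.support := fun h => by have := hp0 a h; omega
  have hbp : b ∉ p.support := fun h => by have := hp0 b h; omega
  have hq1 : (p.concat hbt.symm).IsPath := hp.concat hbp _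
  have hq : (SimpleGraph.Walk.cons has (p.concat hbt.symm)).IsPath := by
    apply hq1.cons
    simp [SimpleGraph.Walk.support_concat, hap, hab]
  generalize hqq : SimpleGraph.Walk.cons has (p.concat hbt.symm) = q at hq
  have hnil : ¬ q.Nil := by rw [← hqq]; simp
  have hsup : ∀ x ∈ q.support, x = a ∨ x = b ∨ x ∈ p.support := by
    intro x hx
    rw [← hqq] at hx
    simp [SimpleGraph.Walk.support_concat] at hx
    tauto
  have : q.toSubgraph.spanningCoe ≤ H := by
    apply ext_le hH (SimpleGraph.Subgraph.spanningCoe_le _)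
    intro x
    by_cases hx : x ∈ q.support
    · by_cases hxa : x = a
      · subst hxa
        right; right
        refine ⟨ha, ?_⟩
        rw [dg_sub, hq.neighborSet_toSubgraph_startpoint hnil]; simp
      by_cases hxb : x = b
      · subst hxb
        right; right
        refine ⟨hb, ?_⟩
        rw [dg_sub, hq.neighborSet_toSubgraph_endpoint hnil]; simp
      right; left
      have hxp := ((hsup x hx).resolve_left hxa).resolve_left hxb
      refine ⟨hp0 x hxp, ?_⟩
      obtain ⟨i, hi, hil⟩ := SimpleGraph.Walk.mem_support_iff_exists_getVert.1 hx
      have hi0 : i ≠ 0 := by rintro rfl; simp at hi; exact hxa hi.symm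
      have hi1 : i ≠ q.length := by rintro rfl; simp at hi; exact hxb hi.symm
      rw [dg_sub, ← hi, hq.ncard_neighborSet_toSubgraph_internal_eq_two hi0 (by omega)]
    · left
      rw [dg_eq_zero]
      intro y hy
      exact hx (SimpleGraph.Walk.mem_support_of_adj_toSubgraph hy)
  have hadj : q.toSubgraph.Adj a s := by
    rw [SimpleGraph.Walk.adj_toSubgraph_iff_mem_edges, ← hqq]; simp
  have h1 : H.Adj a s := this hadj
  exact dg_eq_zero.1 hs a h1.symm

def IsZ (G H : SimpleGraph V) (z : V) : Prop :=
  dg H z = 2 ∧ ∃ s t, s ≠ t ∧ G.Adj z s ∧ G.Adj z t ∧ dg H s = 0 ∧ (out G H).Reachable s t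

theorem z_core {G H : SimpleGraph V} {z : V} (hz : IsZ G H z) :
    ∃ C, Core G C ∧ z ∈ C ∧ ∀ x ∈ C, x = z ∨ (dg H x = 0 ∧ ∃ s, G.Adj z s ∧ dg H s = 0 ∧
      (out G H).Reachable s x) := by
  obtain ⟨h2, s, t, hst, hs, ht, hs0, hr⟩ := hz
  obtain ⟨p, hp, hps⟩ := out_path hr
  have hp0 : ∀ z ∈ p.support, dg H z = 0 := fun z hz => out_reach (hps z hz) hs0
  have hzp : z ∉ p.support := fun h => by have := hp0 z h; omega
  have hc : (SimpleGraph.Walk.cons hs (p.concat ht.symm)).IsCycle := by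
    rw [SimpleGraph.Walk.cons_isCycle_iff]
    refine ⟨hp.concat hzp _, ?_⟩
    rw [SimpleGraph.Walk.edges_concat]
    simp only [List.concat_eq_append, List.mem_append, List.mem_singleton, not_or]
    constructor
    · intro h
      exact hzp (SimpleGraph.Walk.fst_mem_support_of_mem_edges _ h)
    · rw [Sym2.eq_swap]
      intro h
      have := Sym2.congr_left.1 h
      exact hst this
  refine ⟨_, cycle_core hc, by simp, ?_⟩
  intro x hx
  simp [SimpleGraph.Walk.support_concat] at hx
  have : x = z ∨ x ∈ p.support := by tauto
  rcases this with h | h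
  · exact Or.inl h
  · exact Or.inr ⟨hp0 x h, s, hs, hs0, hps x h⟩

/-- A core avoiding branch vertices and `Z` lies inside `H`. -/
theorem core_inside {G H : SimpleGraph V} (hH : Maximal (Good G) H) {C : Finset V} (hC : Core G C)
    (h3 : ∀ x ∈ C, dg H x ≠ 3) (hZ : ∀ x ∈ C, ¬ IsZ G H x) : ∀ x ∈ C, dg H x = 2 := by
  have h02 : ∀ x ∈ C, dg H x = 0 ∨ dg H x = 2 := by
    intro x hx
    have := hH.prop.2 x
    have := h3 x hx
    omega
  by_contra hcon
  push Not at hcon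
  obtain ⟨t, htC, ht⟩ := hcon
  have ht0 : dg H t = 0 := (h02 t htC).resolve_right ht
  -- the part of the core in the component of `t`
  let A := C.filter fun x => (out G H).Reachable t x
  have hA0 : ∀ x ∈ A, dg H x = 0 := fun x hx => out_reach (mem_filter.1 hx).2 ht0
  have htA : t ∈ A := mem_filter.2 ⟨htC, SimpleGraph.Reachable.refl _⟩
  have hstep : ∀ x ∈ A, ∀ y ∈ C, G.Adj x y → y ∉ A → dg H y = 2 := by
    intro x hx y hy hxy hyA
    refine (h02 y hy).resolve_left fun h0 => hyA ?_
    refine mem_filter.2 ⟨hy, (mem_filter.1 hx).2.trans ?_⟩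
    exact SimpleGraph.Adj.reachable (G := out G H) ⟨hxy, hA0 x hx, h0⟩
  have hcore : ∃ B ⊆ A, Core G B := by
    by_cases hex : ∃ w ∈ A, ∃ y ∈ C, G.Adj w y ∧ y ∉ A
    · obtain ⟨w, hw, y, hy, hwy, hyA⟩ := hex
      have hy2 := hstep w hw y hy hwy hyA
      have huniq : ∀ x ∈ A, ∀ y' ∈ C, G.Adj x y' → y' ∉ A → x = w ∧ y' = y := by
        intro x hx y' hy' hxy' hyA'
        have hy2' := hstep x hx y' hy' hxy' hyA'
        have hr : (out G H).Reachable w x := (mem_filter.1 hw).2.symm.trans (mem_filter.1 hx).2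
        have e : y' = y := by
          by_contra hne
          exact attach hH (Ne.symm hne) hy2 hy2' (hA0 w hw) hr hwy.symm hxy'.symm
        refine ⟨?_, e⟩
        subst e
        by_contra hne
        exact hZ y' hy ⟨hy2, w, x, Ne.symm hne, hwy.symm, hxy'.symm, hA0 w hw, hr⟩
      refine core_of_exception _ A w le_rfl hw ?_ ?_
      · obtain ⟨a, ha, b, hb, hab, h1, h2⟩ := hC.2 w (mem_filter.1 hw).1
        by_cases haA : a ∈ A
        · exact ⟨a, haA, h1⟩
        · by_cases hbA : b ∈ A
          · exact ⟨b, hbA, h2⟩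
          · exact absurd ((huniq w hw a ha h1 haA).2.trans (huniq w hw b hb h2 hbA).2.symm) hab
      · intro x hx hxw
        obtain ⟨a, ha, b, hb, hab, h1, h2⟩ := hC.2 x (mem_filter.1 hx).1
        refine ⟨a, ?_, b, ?_, hab, h1, h2⟩
        · by_contra h; exact hxw (huniq x hx a ha h1 h).1
        · by_contra h; exact hxw (huniq x hx b hb h2 h).1
    · push Not at hex
      refine ⟨A, Subset.rfl, ⟨t, htA⟩, fun x hx => ?_⟩
      obtain ⟨a, ha, b, hb, hab, h1, h2⟩ := hC.2 x (mem_filter.1 hx).1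
      exact ⟨a, hex x hx a ha h1, b, hex x hx b hb h2, hab, h1, h2⟩
  obtain ⟨B, hBA, hB⟩ := hcore
  obtain ⟨x, hx, hx0⟩ := no_core_outside hH hB
  exact hx0 (hA0 x (hBA hx))

theorem core_closed {G H : SimpleGraph V} (hH : Maximal (Good G) H) {C : Finset V} (hC : Core G C)
    (h2 : ∀ x ∈ C, dg H x = 2) {x y : V} (hx : x ∈ C) (h : H.Reachable x y) : y ∈ C := by
  obtain ⟨p⟩ := h
  induction p with
  | nil => exact hx
  | @cons u v w h _ ih =>
    apply ih
    obtain ⟨a, ha, b, hb, hab, h1, h3⟩ := hC.2 u hx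
    have ha' := edge_in hH (h2 u hx) (h2 a ha) h1
    have hb' := edge_in hH (h2 u hx) (h2 b hb) h3
    have : ({a, b} : Finset V) = nb H u := by
      apply eq_of_subset_of_card_le
      · intro z hz
        simp only [mem_insert, mem_singleton] at hz
        rcases hz with rfl | rfl <;> simpa
      · rw [card_pair hab]; exact (h2 u hx).le
    have hv : v ∈ nb H u := by simpa using h
    rw [← this] at hv
    simp only [mem_insert, mem_singleton] at hv
    rcases hv with rfl | rfl <;> assumption

noncomputable def rep (H : SimpleGraph V) (x : V) : V := (H.connectedComponentMk x).out

theorem rep_reach (H : SimpleGraph V) (x : V) : H.Reachable x (rep H x) :=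
  (SimpleGraph.ConnectedComponent.exact (Quot.out_eq (H.connectedComponentMk x))).symm

theorem rep_eq {H : SimpleGraph V} {x y : V} (h : H.Reachable x y) : rep H x = rep H y := by
  unfold rep
  rw [SimpleGraph.ConnectedComponent.sound h]

def IsD (G H : SimpleGraph V) (x : V) : Prop :=
  rep H x = x ∧ ∀ y, H.Reachable x y → dg H y = 2 ∧ ¬ IsZ G H y

theorem pack_of_finset {G : SimpleGraph V} {R : Finset V} {k : ℕ} (hk : k ≤ R.card)
    (c : V → Finset V) (hc : ∀ x ∈ R, Core G (c x))
    (hd : ∀ x ∈ R, ∀ y ∈ R, x ≠ y → Disjoint (c x) (c y)) : Pack G k := by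
  obtain ⟨f⟩ : Nonempty (Fin k ↪ R) := Function.Embedding.nonempty_of_card_le (by simpa using hk)
  refine ⟨fun i => c (f i), fun i => hc _ (f i).2, fun i j hij => hd _ (f i).2 _ (f j).2 ?_⟩
  intro h
  exact hij (f.injective (Subtype.ext h))

theorem pack_R {G H : SimpleGraph V} (hH : Maximal (Good G) H) {k : ℕ}
    (hk : k ≤ (univ.filter fun x => IsZ G H x ∨ IsD G H x).card) : Pack G k := by
  have hz : ∀ z, ∃ C, IsZ G H z → Core G C ∧ z ∈ C ∧ ∀ x ∈ C, x = z ∨ (dg H x = 0 ∧ ∃ s,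
      G.Adj z s ∧ dg H s = 0 ∧ (out G H).Reachable s x) := by
    intro z
    by_cases h : IsZ G H z
    · obtain ⟨C, hC⟩ := z_core h
      exact ⟨C, fun _ => hC⟩
    · exact ⟨∅, fun h' => absurd h' h⟩
  choose cz hcz using hz
  have hDZ : ∀ x, IsD G H x → ¬ IsZ G H x := fun x hx => (hx.2 x (SimpleGraph.Reachable.refl _)).2
  have hmix : ∀ x y, IsZ G H x → IsD G H y →
      Disjoint (cz x) (univ.filter fun w => H.Reachable y w) := by
    intro x y hx hy
    rw [disjoint_left]
    intro w hw hw'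
    have hyw := (mem_filter.1 hw').2
    have h2 := hy.2 w hyw
    rcases (hcz x hx).2.2 w hw with rfl | h
    · exact h2.2 hx
    · omega
  refine pack_of_finset hk
    (fun x => if IsZ G H x then cz x else univ.filter fun y => H.Reachable x y) ?_ ?_
  · intro x hx
    split_ifs with h
    · exact (hcz x h).1
    · have hD : IsD G H x := (mem_filter.1 hx).2.resolve_left h
      refine ⟨⟨x, by simp⟩, ?_⟩
      intro y hy
      have hxy := (mem_filter.1 hy).2
      obtain ⟨a, b, hab, h1, h2⟩ := exists_two_of_dg (hD.2 y hxy).1.ge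
      exact ⟨a, by simpa using hxy.trans h1.reachable, b, by simpa using hxy.trans h2.reachable,
        hab, hH.prop.1 h1, hH.prop.1 h2⟩
  · intro x hx y hy hxy
    have hx := (mem_filter.1 hx).2
    have hy := (mem_filter.1 hy).2
    split_ifs with h h' h'
    · rw [disjoint_left]
      intro w hw hw'
      rcases (hcz x h).2.2 w hw with e | ⟨h0, s, hs, hs0, hr⟩ <;>
        rcases (hcz y h').2.2 w hw' with e' | ⟨h0', s', hs', hs0', hr'⟩
      · exact hxy (e.symm.trans e')
      · have := h.1; rw [← e] at this; omega
      · have := h'.1; rw [← e'] at this; omega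
      · exact attach hH hxy h.1 h'.1 hs0 (hr.trans hr'.symm) hs hs'
    · exact hmix x y h (hy.resolve_left h')
    · exact (hmix y x h' (hx.resolve_left h)).symm
    · have hx := hx.resolve_left h
      have hy := hy.resolve_left h'
      rw [disjoint_left]
      intro w hw hw'
      have h1 := (mem_filter.1 hw).2
      have h2 := (mem_filter.1 hw').2
      apply hxy
      rw [← hx.1, ← hy.1]
      exact rep_eq (h1.trans h2.symm)

theorem main (G : SimpleGraph V) (k : ℕ) (hk : 2 ≤ k) :
    Pack G k ∨ ∃ X : Finset V, X.card ≤ 12 * k ^ 2 + 15 - 27 * k ∧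
      ∀ C, Core G C → ∃ x ∈ C, x ∈ X := by
  by_cases hp : Pack G k
  · exact Or.inl hp
  right
  obtain ⟨H, hH⟩ := exists_max G
  have hU : ((univ.filter fun x => dg H x = 3).card : ℤ) ≤ 12 * (k : ℤ) ^ 2 - 28 * k + 16 := by
    by_contra hcon
    apply hp
    refine (packP k (by omega) H ?_ ?_).mono hH.prop.1
    · intro x; have := hH.prop.2 x; omega
    · have : ((univ.filter fun x => dg H x = 3).card : ℤ) = Phi H := by
        rw [card_filter, Nat.cast_sum]
        refine sum_congr rfl fun x _ => ?_
        rcases hH.prop.2 x with h | h | h <;> rw [h] <;> rfl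
      rw [← this]; omega
  have hR : (univ.filter fun x => IsZ G H x ∨ IsD G H x).card + 1 ≤ k := by
    by_contra hcon
    exact hp (pack_R hH (by omega))
  refine ⟨(univ.filter fun x => dg H x = 3) ∪ (univ.filter fun x => IsZ G H x ∨ IsD G H x), ?_, ?_⟩
  · refine (card_union_le _ _).trans ?_
    apply Nat.le_sub_of_add_le
    have hR' : ((univ.filter fun x => IsZ G H x ∨ IsD G H x).card : ℤ) + 1 ≤ k := by
      exact_mod_cast hR
    generalize (univ.filter fun x => IsZ G H x ∨ IsD G H x).card = r at *
    generalize (univ.filter fun x => dg H x = 3).card = m at *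
    zify
    linarith
  · intro C hC
    by_contra hcon
    push Not at hcon
    have h3 : ∀ x ∈ C, dg H x ≠ 3 := fun x hx h => hcon x hx (by simp [h])
    have hZ : ∀ x ∈ C, ¬ IsZ G H x := fun x hx h => hcon x hx (by simp [h])
    have hD : ∀ x ∈ C, ¬ IsD G H x := fun x hx h => hcon x hx (by simp [h])
    have h2 := core_inside hH hC h3 hZ
    obtain ⟨x, hx⟩ := hC.1
    have hr := rep_reach H x
    have hrC := core_closed hH hC h2 hx hr
    refine hD _ hrC ⟨(rep_eq hr).symm, fun y hy => ?_⟩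
    have hyC := core_closed hH hC h2 hrC hy
    exact ⟨h2 y hyC, hZ y hyC⟩

end EP

/-- Bodlaender's constructive Erdős–Pósa theorem: for every `k ≥ 2`, every finite
graph either contains `k` pairwise vertex-disjoint cycles or has a feedback vertex
set of size at most `12k² − 27k + 15`. -/
theorem erdos_posa_bodlaender {V : Type*} [Fintype V] (G : SimpleGraph V)
    (k : ℕ) (hk : 2 ≤ k) :
    (∃ (v : Fin k → V) (c : ∀ i, G.Walk (v i) (v i)),
      (∀ i, (c i).IsCycle) ∧
      (∀ i j, i ≠ j → ∀ u, u ∈ (c i).support → u ∉ (c j).support)) ∨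
    (∃ S : Set V, S.ncard ≤ 12 * k ^ 2 + 15 - 27 * k ∧ (G.induce Sᶜ).IsAcyclic) := by
  rcases EP.main G k hk with ⟨f, hf, hd⟩ | ⟨X, hX, hC⟩
  · left
    choose v c hc hs using fun i => EP.core_cycle (hf i)
    exact ⟨v, c, hc, fun i j hij u hu hu' =>
      Finset.disjoint_left.1 (hd i j hij) (hs i u hu) (hs j u hu')⟩
  · right
    refine ⟨X, by rwa [Set.ncard_coe_finset], ?_⟩
    intro v c hc
    have hc' := hc.map (f := (SimpleGraph.Embedding.induce (G := G) (X : Set V)ᶜ).toHom)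
      (SimpleGraph.Embedding.induce (G := G) (X : Set V)ᶜ).injective
    obtain ⟨x, hx, hxX⟩ := hC _ (EP.cycle_core (c := c.map
      (SimpleGraph.Embedding.induce (G := G) (X : Set V)ᶜ).toHom) hc')
    classical
    rw [List.mem_toFinset, SimpleGraph.Walk.support_map] at hx
    obtain ⟨y, hy, rfl⟩ := List.mem_map.1 hx
    exact y.2 hxX
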